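/- Define h(w) := Y(w)·Û″(Y(w)) for w ∈ (0, w*). Then h is strictly increasing on each of the intervals (0, wα), (wα, wo), and (wo, w*); moreover, h is convex on (0, wα) and on (wo, w*), and h is concave on (wα, wo). -/

import Mathlib

open Real Set

noncomputable section

/-- The system (S) of two equations in the unknowns `y` and `η`. -/
def SystemS (κ δ p α y η : ℝ) : Prop :=
  α * Real.log η - Real.log y + α / (η * (1 - p)) - 1 / y = α * (1 + p) - 1 ∧
  α ^ (1 - p * (1 + κ * δ)) * (p * (1 + κ * δ) - 1) *
      (κ * η ^ (1 + κ * δ) / (1 + κ * δ) - η ^ (κ * δ) / (δ * (1 - p))) +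
    (κ * y ^ (1 + κ * δ) / (1 + κ * δ) - y ^ (κ * δ) / δ) =
  (α ^ (1 - p * (1 + κ * δ)) - 1) / (δ * (1 + κ * δ))

def C1 (κ δ p α η : ℝ) : ℝ :=
  -(κ * α / (1 + κ * δ)) *
    (Real.log η - p * Real.log α + 1 / (η * (1 - p)) + 1 / (1 + κ * δ))

def C2 (κ δ p α η : ℝ) : ℝ :=
  α ^ (1 - p * (1 + κ * δ)) / (1 + κ * δ) *
    (κ * η ^ (1 + κ * δ) / (1 + κ * δ) - η ^ (κ * δ) / (δ * (1 - p)))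

def C3 (κ δ p α η : ℝ) : ℝ :=
  -(κ * α / (1 + κ * δ)) * (Real.log η + 1 / (η * (1 - p)) - (1 + p))

def C4 (κ δ p α η : ℝ) : ℝ :=
  α ^ (1 - p * (1 + κ * δ)) / (1 + κ * δ) *
    (κ * η ^ (1 + κ * δ) / (1 + κ * δ) - η ^ (κ * δ) / (δ * (1 - p)) -
      1 / (δ * (1 + κ * δ) * (p * (1 + κ * δ) - 1)))

def C5 (κ δ p α η : ℝ) : ℝ :=
  -(κ / (1 + κ * δ)) *
    (α * Real.log η + α / (η * (1 - p)) + (1 - α) * (1 + p) + 1 / (1 + κ * δ))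

def C6 (κ δ p α η : ℝ) : ℝ :=
  C2 κ δ p α η -
    (α ^ (1 - p * (1 + κ * δ)) - 1) / (δ * (1 + κ * δ) ^ 2 * (p * (1 + κ * δ) - 1))

/-- The dual function `Û`, defined piecewise (here `η` stands for `η*`). -/
def Uhat (κ δ p α η : ℝ) (y : ℝ) : ℝ :=
  if α ^ (-p) ≤ y then
    C1 κ δ p α η * y + C2 κ δ p α η * y ^ (-(κ * δ)) +
      κ * α / (1 + κ * δ) * (y * Real.log y) + α ^ (1 - p) / (δ * (1 - p))
  else if 1 < y then
    C3 κ δ p α η * y + C4 κ δ p α η * y ^ (-(κ * δ)) +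
      κ * p ^ 3 / ((1 - p) * (p * (1 + κ * δ) - 1)) * y ^ (-(1 - p) / p)
  else
    C5 κ δ p α η * y + C6 κ δ p α η * y ^ (-(κ * δ)) +
      κ / (1 + κ * δ) * (y * Real.log y) + 1 / (δ * (1 - p))


/-- If `Y` is a right inverse of `-G` and `-H'/G'` is antitone, then `H ∘ Y` is convex. -/
lemma convexOn_comp_rightInverse {G H g h Y : ℝ → ℝ} {lo hi a b : ℝ}
    (hG : ∀ y ∈ Ioo lo hi, HasDerivAt G (g y) y) (hH : ∀ y ∈ Ioo lo hi, HasDerivAt H (h y) y)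
    (hg : ∀ y ∈ Ioo lo hi, 0 < g y)
    (hR : AntitoneOn (fun y => -h y / g y) (Ioo lo hi))
    (hY : ∀ w ∈ Ioo a b, Y w ∈ Ioo lo hi ∧ -G (Y w) = w) :
    ConvexOn ℝ (Ioo a b) (fun w => H (Y w)) := by
  have hGm : StrictMonoOn G (Ioo lo hi) := by
    apply strictMonoOn_of_deriv_pos (convex_Ioo _ _)
    · exact fun y hy => (hG y hy).continuousAt.continuousWithinAt
    · intro y hy
      rw [interior_Ioo] at hy
      rw [(hG y hy).deriv]
      exact hg y hy
  have hanti : ∀ u ∈ Ioo a b, ∀ v ∈ Ioo a b, u < v → Y v < Y u := by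
    intro u hu v hv huv
    rw [← hGm.lt_iff_lt (hY v hv).1 (hY u hu).1]
    linarith [(hY u hu).2, (hY v hv).2]
  have hslope : ∀ u ∈ Ioo a b, ∀ v ∈ Ioo a b, u < v →
      ∃ ξ ∈ Ioo (Y v) (Y u), (H (Y v) - H (Y u)) / (v - u) = -h ξ / g ξ := by
    intro u hu v hv huv
    have hsub : Icc (Y v) (Y u) ⊆ Ioo lo hi := fun x hx =>
      ⟨(hY v hv).1.1.trans_le hx.1, hx.2.trans_lt (hY u hu).1.2⟩
    obtain ⟨ξ, hξ, he⟩ := exists_ratio_hasDerivAt_eq_ratio_slope G g (hanti u hu v hv huv)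
      (fun x hx => (hG x (hsub hx)).continuousAt.continuousWithinAt)
      (fun x hx => hG x (hsub (Ioo_subset_Icc_self hx))) H h
      (fun x hx => (hH x (hsub hx)).continuousAt.continuousWithinAt)
      (fun x hx => hH x (hsub (Ioo_subset_Icc_self hx)))
    refine ⟨ξ, hξ, ?_⟩
    have hgξ := hg ξ (hsub (Ioo_subset_Icc_self hξ))
    have huv' : G (Y u) - G (Y v) = v - u := by linarith [(hY u hu).2, (hY v hv).2]
    rw [div_eq_div_iff (sub_pos.2 huv).ne' hgξ.ne']
    rw [huv'] at he
    linarith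
  refine convexOn_of_slope_mono_adjacent (convex_Ioo _ _) ?_
  intro x y z hx hz hxy hyz
  have hy : y ∈ Ioo a b := ⟨hx.1.trans hxy, hyz.trans hz.2⟩
  obtain ⟨ξ, hξ, he⟩ := hslope x hx y hy hxy
  obtain ⟨ζ, hζ, he'⟩ := hslope y hy z hz hyz
  simp only [he, he']
  exact hR ⟨(hY z hz).1.1.trans hζ.1, hζ.2.trans (hY y hy).1.2⟩
    ⟨(hY y hy).1.1.trans hξ.1, hξ.2.trans (hY x hx).1.2⟩ (hζ.2.trans hξ.1).le

lemma mul_rpow_sub_one {y : ℝ} (hy : 0 < y) (a : ℝ) : y * y ^ (a - 1) = y ^ a := by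
  rw [rpow_sub_one hy.ne']
  field_simp

lemma hasDerivAt_rpow_combination (K L c r : ℝ) {y : ℝ} (hy : 0 < y) :
    HasDerivAt (fun y : ℝ => K * y ^ (-c) + L * y ^ (-r))
      (-(c * K * y ^ (-c - 1) + r * L * y ^ (-r - 1))) y := by
  have h1 := (hasDerivAt_rpow_const (p := -c) (Or.inl hy.ne')).const_mul K
  have h2 := (hasDerivAt_rpow_const (p := -r) (Or.inl hy.ne')).const_mul L
  exact (h1.add h2).congr_deriv (by ring)

/-- Elasticities of `K y^{-c}` and `L y^{-r}` combine monotonically. -/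
lemma elasticity_cross_sub {K L c r u v : ℝ} (hu : 0 < u) (huv : u ≤ v) (hrc : r < c) :
    ∃ t : ℝ, 0 ≤ t ∧
      (c * K * u ^ (-c - 1) + r * L * u ^ (-r - 1)) * (K * v ^ (-c - 1) + L * v ^ (-r - 1)) -
        (c * K * v ^ (-c - 1) + r * L * v ^ (-r - 1)) * (K * u ^ (-c - 1) + L * u ^ (-r - 1)) =
      K * L * t := by
  have hv : 0 < v := hu.trans_le huv
  refine ⟨(c - r) * (u ^ (-c - 1) * v ^ (-r - 1) - v ^ (-c - 1) * u ^ (-r - 1)),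
    mul_nonneg (by linarith) ?_, by ring⟩
  have e : ∀ x : ℝ, 0 < x → x ^ (-c - 1) = x ^ (-(c - r)) * x ^ (-r - 1) := by
    intro x hx
    rw [← rpow_add hx]
    congr 1
    ring
  rw [e u hu, e v hv]
  have hle : v ^ (-(c - r)) ≤ u ^ (-(c - r)) :=
    rpow_le_rpow_of_nonpos hu huv (by linarith)
  have : 0 < u ^ (-r - 1) * v ^ (-r - 1) := by positivity
  nlinarith

section Piece

variable {K L c r lo hi a b : ℝ} {G Y : ℝ → ℝ}

lemma strictMonoOn_rpow_comp_rightInverse (hlo : 0 < lo)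
    (hG : StrictMonoOn G (Ioo lo hi))
    (hpos' : ∀ y ∈ Ioo lo hi, 0 < c * K * y ^ (-c - 1) + r * L * y ^ (-r - 1))
    (hY : ∀ w ∈ Ioo a b, Y w ∈ Ioo lo hi ∧ -G (Y w) = w) :
    StrictMonoOn (fun w => K * Y w ^ (-c) + L * Y w ^ (-r)) (Ioo a b) := by
  have hanti : StrictAntiOn (fun y : ℝ => K * y ^ (-c) + L * y ^ (-r)) (Ioo lo hi) := by
    apply strictAntiOn_of_deriv_neg (convex_Ioo _ _)
    · exact fun y hy => (hasDerivAt_rpow_combination K L c r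
        (hlo.trans hy.1)).continuousAt.continuousWithinAt
    · intro y hy
      rw [interior_Ioo] at hy
      rw [(hasDerivAt_rpow_combination K L c r (hlo.trans hy.1)).deriv]
      linarith [hpos' y hy]
  intro u hu v hv huv
  refine hanti (hY v hv).1 (hY u hu).1 ?_
  rw [← hG.lt_iff_lt (hY v hv).1 (hY u hu).1]
  linarith [(hY u hu).2, (hY v hv).2]

lemma convexOn_rpow_comp_rightInverse (hlo : 0 < lo) (hrc : r < c) (hKL : 0 ≤ K * L)
    (hG : ∀ y ∈ Ioo lo hi, HasDerivAt G (K * y ^ (-c - 1) + L * y ^ (-r - 1)) y)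
    (hpos : ∀ y ∈ Ioo lo hi, 0 < K * y ^ (-c - 1) + L * y ^ (-r - 1))
    (hY : ∀ w ∈ Ioo a b, Y w ∈ Ioo lo hi ∧ -G (Y w) = w) :
    ConvexOn ℝ (Ioo a b) (fun w => K * Y w ^ (-c) + L * Y w ^ (-r)) := by
  refine convexOn_comp_rightInverse hG
    (fun y hy => hasDerivAt_rpow_combination K L c r (hlo.trans hy.1)) hpos ?_ hY
  intro u hu v hv huv
  obtain ⟨t, ht, he⟩ := elasticity_cross_sub (K := K) (L := L) (hlo.trans hu.1) huv hrc
  have := mul_nonneg hKL ht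
  simp only [neg_neg]
  rw [div_le_div_iff₀ (hpos v hv) (hpos u hu)]
  linarith

lemma concaveOn_rpow_comp_rightInverse (hlo : 0 < lo) (hrc : r < c) (hKL : K * L ≤ 0)
    (hG : ∀ y ∈ Ioo lo hi, HasDerivAt G (K * y ^ (-c - 1) + L * y ^ (-r - 1)) y)
    (hpos : ∀ y ∈ Ioo lo hi, 0 < K * y ^ (-c - 1) + L * y ^ (-r - 1))
    (hY : ∀ w ∈ Ioo a b, Y w ∈ Ioo lo hi ∧ -G (Y w) = w) :
    ConcaveOn ℝ (Ioo a b) (fun w => K * Y w ^ (-c) + L * Y w ^ (-r)) := by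
  rw [← neg_convexOn_iff]
  refine convexOn_comp_rightInverse (H := fun y => -(K * y ^ (-c) + L * y ^ (-r))) hG
    (fun y hy => (hasDerivAt_rpow_combination K L c r (hlo.trans hy.1)).fun_neg) hpos ?_ hY
  intro u hu v hv huv
  obtain ⟨t, ht, he⟩ := elasticity_cross_sub (K := K) (L := L) (hlo.trans hu.1) huv hrc
  have := mul_nonneg (neg_nonneg.2 hKL) ht
  simp only [neg_neg]
  rw [div_le_div_iff₀ (hpos v hv) (hpos u hu)]
  linarith

end Piece

lemma hasDerivAt_of_eqOn_Iic_Ici {f f₁ f₂ : ℝ → ℝ} {a d : ℝ} {s : Set ℝ} (hs : s ∈ nhds a)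
    (h₁ : ∀ y ∈ s, y ≤ a → f y = f₁ y) (h₂ : ∀ y ∈ s, a ≤ y → f y = f₂ y)
    (hd₁ : HasDerivAt f₁ d a) (hd₂ : HasDerivAt f₂ d a) : HasDerivAt f d a := by
  have ha : a ∈ s := mem_of_mem_nhds hs
  have hl : HasDerivWithinAt f d (Iic a) a := by
    refine hd₁.hasDerivWithinAt.congr_of_eventuallyEq ?_ (h₁ a ha le_rfl)
    filter_upwards [mem_nhdsWithin_of_mem_nhds hs, self_mem_nhdsWithin] with y hy hya
    exact h₁ y hy hya
  have hr : HasDerivWithinAt f d (Ici a) a := by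
    refine hd₂.hasDerivWithinAt.congr_of_eventuallyEq ?_ (h₂ a ha le_rfl)
    filter_upwards [mem_nhdsWithin_of_mem_nhds hs, self_mem_nhdsWithin] with y hy hya
    exact h₂ y hy hya
  have := hl.union hr
  rwa [Iic_union_Ici, hasDerivWithinAt_univ] at this

lemma rpow_mul_lt_one {k y : ℝ} (hk : 0 < k) (hy0 : 0 < y) (hy1 : y < 1) :
    y ^ k * (1 + k - k * y) < 1 := by
  have h1 : y ^ k ≤ exp (-(k * (1 - y))) := by
    rw [rpow_def_of_pos hy0]
    apply exp_le_exp.2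
    nlinarith [log_le_sub_one_of_pos hy0]
  have hpos : 0 < k * (1 - y) := mul_pos hk (by linarith)
  have h2 := add_one_lt_exp hpos.ne'
  calc y ^ k * (1 + k - k * y) ≤ exp (-(k * (1 - y))) * (1 + k - k * y) := by
        apply mul_le_mul_of_nonneg_right h1; nlinarith
    _ < exp (-(k * (1 - y))) * exp (k * (1 - y)) := by
        apply mul_lt_mul_of_pos_left _ (exp_pos _); linarith
    _ = 1 := by rw [← exp_add]; simp

section Constants

variable {κ δ p α y η : ℝ}

lemma C6_eq_of_systemS (hκ : 0 < κ) (hδ : 0 < δ) (hq : 0 < p * (1 + κ * δ) - 1) (hy : 0 < y)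
    (hS : SystemS κ δ p α y η) :
    (1 + κ * δ) ^ 2 * (p * (1 + κ * δ) - 1) * δ * C6 κ δ p α η =
      y ^ (κ * δ) * (1 + κ * δ - κ * δ * y) := by
  have hc : 0 < 1 + κ * δ := by positivity
  have h2 := hS.2
  have e : y ^ (1 + κ * δ) = y * y ^ (κ * δ) := by rw [rpow_add hy, rpow_one]
  rw [e] at h2
  unfold C6 C2
  generalize κ * η ^ (1 + κ * δ) / (1 + κ * δ) - η ^ (κ * δ) / (δ * (1 - p)) = E at *
  generalize α ^ (1 - p * (1 + κ * δ)) = A at *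
  generalize y ^ (κ * δ) = Z at *
  have hq' := hq.ne'
  generalize p * (1 + κ * δ) - 1 = q at *
  field_simp at h2 ⊢
  linarith

lemma C6_pos (hκ : 0 < κ) (hδ : 0 < δ) (hq : 0 < p * (1 + κ * δ) - 1) (hy : y ∈ Ioo (0 : ℝ) 1)
    (hS : SystemS κ δ p α y η) : 0 < C6 κ δ p α η := by
  have h := C6_eq_of_systemS hκ hδ hq hy.1 hS
  have hk : 0 < κ * δ := by positivity
  have h1 : 0 < y ^ (κ * δ) * (1 + κ * δ - κ * δ * y) :=
    mul_pos (rpow_pos_of_pos hy.1 _) (by nlinarith [hy.2])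
  rw [← h] at h1
  exact pos_of_mul_pos_right h1 (by positivity)

lemma C4_eq_C6_sub (hκ : 0 < κ) (hδ : 0 < δ) (hq : 0 < p * (1 + κ * δ) - 1) :
    C4 κ δ p α η = C6 κ δ p α η - 1 / (δ * (1 + κ * δ) ^ 2 * (p * (1 + κ * δ) - 1)) := by
  have hc : 0 < 1 + κ * δ := by positivity
  unfold C4 C6 C2
  have hq' := hq.ne'
  generalize κ * η ^ (1 + κ * δ) / (1 + κ * δ) - η ^ (κ * δ) / (δ * (1 - p)) = E at *
  generalize α ^ (1 - p * (1 + κ * δ)) = A at *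
  generalize p * (1 + κ * δ) - 1 = q at *
  field_simp
  ring

lemma C4_neg (hκ : 0 < κ) (hδ : 0 < δ) (hq : 0 < p * (1 + κ * δ) - 1) (hy : y ∈ Ioo (0 : ℝ) 1)
    (hS : SystemS κ δ p α y η) : C4 κ δ p α η < 0 := by
  have h := C6_eq_of_systemS hκ hδ hq hy.1 hS
  have hc : 0 < 1 + κ * δ := by positivity
  rw [C4_eq_C6_sub hκ hδ hq, sub_neg, lt_div_iff₀ (by positivity)]
  linarith [rpow_mul_lt_one (mul_pos hκ hδ) hy.1 hy.2]

lemma C2_pos (hκ : 0 < κ) (hδ : 0 < δ) (hα : α ∈ Ioo (0 : ℝ) 1)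
    (hq : 0 < p * (1 + κ * δ) - 1) (hy : y ∈ Ioo (0 : ℝ) 1)
    (hS : SystemS κ δ p α y η) : 0 < C2 κ δ p α η := by
  have h := C6_pos hκ hδ hq hy hS
  have hA : 1 < α ^ (1 - p * (1 + κ * δ)) :=
    one_lt_rpow_of_pos_of_lt_one_of_neg hα.1 hα.2 (by linarith)
  have : 0 < (α ^ (1 - p * (1 + κ * δ)) - 1) /
      (δ * (1 + κ * δ) ^ 2 * (p * (1 + κ * δ) - 1)) :=
    div_pos (by linarith) (by positivity)
  unfold C6 at h
  linarith

end Constants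

section Dual

variable (κ δ p α η : ℝ)

/-- The branch of `Û` on `[α^{-p}, ∞)`. -/
def UhatHigh (y : ℝ) : ℝ :=
  C1 κ δ p α η * y + C2 κ δ p α η * y ^ (-(κ * δ)) +
    κ * α / (1 + κ * δ) * (y * Real.log y) + α ^ (1 - p) / (δ * (1 - p))

/-- The branch of `Û` on `(1, α^{-p})`. -/
def UhatMid (y : ℝ) : ℝ :=
  C3 κ δ p α η * y + C4 κ δ p α η * y ^ (-(κ * δ)) +
    κ * p ^ 3 / ((1 - p) * (p * (1 + κ * δ) - 1)) * y ^ (-(1 - p) / p)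

/-- The branch of `Û` on `(0, 1]`. -/
def UhatLow (y : ℝ) : ℝ :=
  C5 κ δ p α η * y + C6 κ δ p α η * y ^ (-(κ * δ)) +
    κ / (1 + κ * δ) * (y * Real.log y) + 1 / (δ * (1 - p))

/-- The derivative of `UhatHigh`. -/
def dUhatHigh (y : ℝ) : ℝ :=
  C1 κ δ p α η - κ * δ * C2 κ δ p α η * y ^ (-(1 + κ * δ)) +
    κ * α / (1 + κ * δ) * (Real.log y + 1)

/-- The derivative of `UhatMid`. -/
def dUhatMid (y : ℝ) : ℝ :=
  C3 κ δ p α η - κ * δ * C4 κ δ p α η * y ^ (-(1 + κ * δ)) -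
    κ * p ^ 2 / (p * (1 + κ * δ) - 1) * y ^ (-(1 / p))

/-- The derivative of `UhatLow`. -/
def dUhatLow (y : ℝ) : ℝ :=
  C5 κ δ p α η - κ * δ * C6 κ δ p α η * y ^ (-(1 + κ * δ)) +
    κ / (1 + κ * δ) * (Real.log y + 1)

variable {κ δ p α η} {y : ℝ}

lemma hasDerivAt_log_branch (A B D E k : ℝ) (hy : 0 < y) :
    HasDerivAt (fun y => A * y + B * y ^ (-k) + D * (y * Real.log y) + E)
      (A - k * B * y ^ (-(1 + k)) + D * (Real.log y + 1)) y := by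
  have h1 := (hasDerivAt_id y).const_mul A
  have h2 := (hasDerivAt_rpow_const (p := -k) (Or.inl hy.ne')).const_mul B
  have h3 := ((hasDerivAt_id y).mul (hasDerivAt_log hy.ne')).const_mul D
  refine (((h1.add h2).add h3).add_const E).congr_deriv ?_
  rw [show -(1 + k) = -k - 1 by ring]
  simp only [id]
  field_simp
  ring

lemma hasDerivAt_deriv_log_branch (A B D k : ℝ) (hy : 0 < y) :
    HasDerivAt (fun y => A - k * B * y ^ (-(1 + k)) + D * (Real.log y + 1))
      (k * (1 + k) * B * y ^ (-(1 + k) - 1) + D * y ^ (-(0 : ℝ) - 1)) y := by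
  have h2 := (hasDerivAt_rpow_const (p := -(1 + k)) (Or.inl hy.ne')).const_mul (k * B)
  have h3 := ((hasDerivAt_log hy.ne').add_const 1).const_mul D
  refine ((h2.const_sub A).add h3).congr_deriv ?_
  rw [show -(0 : ℝ) - 1 = -1 by ring, rpow_neg_one]
  ring

lemma hasDerivAt_UhatHigh (hy : 0 < y) :
    HasDerivAt (UhatHigh κ δ p α η) (dUhatHigh κ δ p α η y) y :=
  hasDerivAt_log_branch _ _ _ _ _ hy

lemma hasDerivAt_UhatLow (hy : 0 < y) :
    HasDerivAt (UhatLow κ δ p α η) (dUhatLow κ δ p α η y) y :=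
  hasDerivAt_log_branch _ _ _ _ _ hy

lemma hasDerivAt_UhatMid (hp0 : 0 < p) (hp2 : p < 1) (hq : 0 < p * (1 + κ * δ) - 1) (hy : 0 < y) :
    HasDerivAt (UhatMid κ δ p α η) (dUhatMid κ δ p α η y) y := by
  have h1 := (hasDerivAt_id y).const_mul (C3 κ δ p α η)
  have h2 := (hasDerivAt_rpow_const (p := -(κ * δ)) (Or.inl hy.ne')).const_mul (C4 κ δ p α η)
  have h3 := (hasDerivAt_rpow_const (p := -(1 - p) / p) (Or.inl hy.ne')).const_mul
    (κ * p ^ 3 / ((1 - p) * (p * (1 + κ * δ) - 1)))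
  refine ((h1.add h2).add h3).congr_deriv ?_
  unfold dUhatMid
  rw [show -(1 - p) / p - 1 = -(1 / p) by field_simp; ring,
    show -(κ * δ) - 1 = -(1 + κ * δ) by ring]
  have hp3 : 1 - p ≠ 0 := by linarith
  have hq' := hq.ne'
  generalize p * (1 + κ * δ) - 1 = q at *
  field_simp
  ring

lemma hasDerivAt_dUhatHigh (hy : 0 < y) : HasDerivAt (dUhatHigh κ δ p α η)
    (κ * δ * (1 + κ * δ) * C2 κ δ p α η * y ^ (-(1 + κ * δ) - 1) +
      κ * α / (1 + κ * δ) * y ^ (-(0 : ℝ) - 1)) y :=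
  hasDerivAt_deriv_log_branch _ _ _ _ hy

lemma hasDerivAt_dUhatLow (hy : 0 < y) : HasDerivAt (dUhatLow κ δ p α η)
    (κ * δ * (1 + κ * δ) * C6 κ δ p α η * y ^ (-(1 + κ * δ) - 1) +
      κ / (1 + κ * δ) * y ^ (-(0 : ℝ) - 1)) y :=
  hasDerivAt_deriv_log_branch _ _ _ _ hy

lemma hasDerivAt_dUhatMid (hp0 : 0 < p) (hy : 0 < y) : HasDerivAt (dUhatMid κ δ p α η)
    (κ * δ * (1 + κ * δ) * C4 κ δ p α η * y ^ (-(1 + κ * δ) - 1) +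
      κ * p / (p * (1 + κ * δ) - 1) * y ^ (-(1 / p) - 1)) y := by
  have h2 := (hasDerivAt_rpow_const (p := -(1 + κ * δ)) (Or.inl hy.ne')).const_mul
    (κ * δ * C4 κ δ p α η)
  have h3 := (hasDerivAt_rpow_const (p := -(1 / p)) (Or.inl hy.ne')).const_mul
    (κ * p ^ 2 / (p * (1 + κ * δ) - 1))
  refine ((h2.const_sub (C3 κ δ p α η)).sub h3).congr_deriv ?_
  field_simp
  ring

lemma C4_eq_C2_sub : C4 κ δ p α η = C2 κ δ p α η -
    α ^ (1 - p * (1 + κ * δ)) / (δ * (1 + κ * δ) ^ 2 * (p * (1 + κ * δ) - 1)) := by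
  unfold C4 C2
  rw [mul_sub _ _ (1 / _), div_mul_div_comm, mul_one]
  congr 2
  ring

lemma dUhatMid_one (hκ : 0 < κ) (hδ : 0 < δ) (hq : 0 < p * (1 + κ * δ) - 1) :
    dUhatMid κ δ p α η 1 = dUhatLow κ δ p α η 1 := by
  have hc : 0 < 1 + κ * δ := by positivity
  unfold dUhatMid dUhatLow
  rw [C4_eq_C6_sub hκ hδ hq]
  unfold C3 C5
  simp only [one_rpow, log_one]
  have hq' := hq.ne'
  generalize C6 κ δ p α η = X
  rw [div_eq_mul_one_div α]
  generalize 1 / (η * (1 - p)) = Z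
  clear hq
  generalize hqq : p * (1 + κ * δ) - 1 = q at *
  field_simp
  subst hqq
  ring

lemma UhatMid_one (hκ : 0 < κ) (hδ : 0 < δ) (hp2 : p < 1) (hq : 0 < p * (1 + κ * δ) - 1) :
    UhatMid κ δ p α η 1 = UhatLow κ δ p α η 1 := by
  have hc : 0 < 1 + κ * δ := by positivity
  unfold UhatMid UhatLow
  rw [C4_eq_C6_sub hκ hδ hq]
  unfold C3 C5
  simp only [one_rpow, log_one]
  have hq' := hq.ne'
  have hp3 : 1 - p ≠ 0 := by linarith
  generalize C6 κ δ p α η = X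
  rw [div_eq_mul_one_div α]
  generalize 1 / (η * (1 - p)) = Z
  clear hq
  generalize hqq : p * (1 + κ * δ) - 1 = q at *
  field_simp
  subst hqq
  ring

lemma dUhatMid_rpow (hκ : 0 < κ) (hδ : 0 < δ) (hα : 0 < α) (hp0 : 0 < p)
    (hq : 0 < p * (1 + κ * δ) - 1) :
    dUhatMid κ δ p α η (α ^ (-p)) = dUhatHigh κ δ p α η (α ^ (-p)) := by
  have hc : 0 < 1 + κ * δ := by positivity
  have e1 : (α ^ (-p)) ^ (-(1 / p)) = α := by
    rw [← rpow_mul hα.le, show -p * -(1 / p) = 1 by field_simp, rpow_one]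
  have e2 : α ^ (1 - p * (1 + κ * δ)) * (α ^ (-p)) ^ (-(1 + κ * δ)) = α := by
    rw [← rpow_mul hα.le, ← rpow_add hα]
    ring_nf
    exact rpow_one α
  unfold dUhatMid dUhatHigh
  rw [C4_eq_C2_sub, e1, log_rpow hα]
  unfold C1 C3
  have hq' := hq.ne'
  generalize C2 κ δ p α η = X
  generalize 1 / (η * (1 - p)) = Z
  generalize (α ^ (-p)) ^ (-(1 + κ * δ)) = T at *
  generalize α ^ (1 - p * (1 + κ * δ)) = A at *
  have e3 : κ * δ * (X - A / (δ * (1 + κ * δ) ^ 2 * (p * (1 + κ * δ) - 1))) * T =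
      κ * δ * X * T - κ * δ * α / (δ * (1 + κ * δ) ^ 2 * (p * (1 + κ * δ) - 1)) := by
    rw [← e2]; ring
  rw [e3]
  clear hq
  generalize hqq : p * (1 + κ * δ) - 1 = q at *
  field_simp
  subst hqq
  ring

lemma UhatMid_rpow (hκ : 0 < κ) (hδ : 0 < δ) (hα : 0 < α) (hp0 : 0 < p) (hp2 : p < 1)
    (hq : 0 < p * (1 + κ * δ) - 1) :
    UhatMid κ δ p α η (α ^ (-p)) = UhatHigh κ δ p α η (α ^ (-p)) := by
  have hc : 0 < 1 + κ * δ := by positivity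
  have e0 : α ^ (1 - p) = α * α ^ (-p) := by
    rw [sub_eq_add_neg, rpow_add hα, rpow_one]
  have e1 : (α ^ (-p)) ^ (-(1 - p) / p) = α * α ^ (-p) := by
    rw [← e0, ← rpow_mul hα.le, show -p * (-(1 - p) / p) = 1 - p by field_simp]
  have e2 : α ^ (1 - p * (1 + κ * δ)) * (α ^ (-p)) ^ (-(κ * δ)) = α * α ^ (-p) := by
    rw [← e0, ← rpow_mul hα.le, ← rpow_add hα]
    ring_nf
  unfold UhatMid UhatHigh
  rw [C4_eq_C2_sub, e1, log_rpow hα, e0]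
  unfold C1 C3
  have hq' := hq.ne'
  have hp3 : 1 - p ≠ 0 := by linarith
  generalize C2 κ δ p α η = X
  generalize 1 / (η * (1 - p)) = Z
  generalize (α ^ (-p)) ^ (-(κ * δ)) = T at *
  generalize α ^ (1 - p * (1 + κ * δ)) = A at *
  generalize α ^ (-p) = b at *
  have e3 : (X - A / (δ * (1 + κ * δ) ^ 2 * (p * (1 + κ * δ) - 1))) * T =
      X * T - α * b / (δ * (1 + κ * δ) ^ 2 * (p * (1 + κ * δ) - 1)) := by
    rw [← e2]; ring
  rw [e3]
  clear hq
  generalize hqq : p * (1 + κ * δ) - 1 = q at *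
  field_simp
  subst hqq
  ring

lemma dUhatHigh_free_boundary (hκ : 0 < κ) (hδ : 0 < δ) (hα : 0 < α) (hη : 0 < η) (hp2 : p < 1) :
    dUhatHigh κ δ p α η (η * α ^ (-p)) = 0 := by
  have hc : 0 < 1 + κ * δ := by positivity
  have hb : 0 < α ^ (-p) := rpow_pos_of_pos hα _
  have e2 : α ^ (1 - p * (1 + κ * δ)) * (α ^ (-p)) ^ (-(1 + κ * δ)) = α := by
    rw [← rpow_mul hα.le, ← rpow_add hα]
    ring_nf
    exact rpow_one α
  have e3 : η ^ (1 + κ * δ) * η ^ (-(1 + κ * δ)) = 1 := by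
    rw [← rpow_add hη]; simp
  have e4 : η ^ (κ * δ) = η ^ (1 + κ * δ) / η := by
    rw [rpow_add hη, rpow_one]; field_simp
  have hp3 : 1 - p ≠ 0 := by linarith
  unfold dUhatHigh C1 C2
  rw [mul_rpow hη.le hb.le, log_mul hη.ne' hb.ne', log_rpow hα, e4]
  generalize (α ^ (-p)) ^ (-(1 + κ * δ)) = T at *
  generalize α ^ (1 - p * (1 + κ * δ)) = A at *
  generalize η ^ (1 + κ * δ) = E at *
  generalize η ^ (-(1 + κ * δ)) = F at *
  have e5 : κ * δ * (A / (1 + κ * δ) * (κ * E / (1 + κ * δ) - E / η / (δ * (1 - p)))) * (F * T) =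
      κ * δ * ((A * T) / (1 + κ * δ) *
        (κ * (E * F) / (1 + κ * δ) - (E * F) / η / (δ * (1 - p)))) := by
    ring
  rw [e5, e2, e3]
  field_simp
  ring

lemma Uhat_of_le (h : α ^ (-p) ≤ y) : Uhat κ δ p α η y = UhatHigh κ δ p α η y :=
  if_pos h

lemma Uhat_of_lt (h : y < α ^ (-p)) (h1 : 1 < y) : Uhat κ δ p α η y = UhatMid κ δ p α η y := by
  simp [Uhat, UhatMid, h.not_ge, h1]

lemma Uhat_of_le_one (h : 1 < α ^ (-p)) (h1 : y ≤ 1) :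
    Uhat κ δ p α η y = UhatLow κ δ p α η y := by
  simp [Uhat, UhatLow, (h1.trans_lt h).not_ge, h1.not_gt]

lemma hasDerivAt_Uhat_high (hκ : 0 < κ) (hδ : 0 < δ) (hα : α ∈ Ioo (0 : ℝ) 1) (hp0 : 0 < p)
    (hp2 : p < 1) (hq : 0 < p * (1 + κ * δ) - 1) (hy : α ^ (-p) ≤ y) :
    HasDerivAt (Uhat κ δ p α η) (dUhatHigh κ δ p α η y) y := by
  have hb : 1 < α ^ (-p) := one_lt_rpow_of_pos_of_lt_one_of_neg hα.1 hα.2 (by linarith)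
  rcases hy.eq_or_lt with rfl | hlt
  · have hb0 : 0 < α ^ (-p) := by linarith
    refine hasDerivAt_of_eqOn_Iic_Ici (Ioi_mem_nhds hb) ?_ (fun y _ hy => Uhat_of_le hy)
      ?_ (hasDerivAt_UhatHigh hb0) (f₁ := UhatMid κ δ p α η)
    · intro y hy hyb
      rcases hyb.eq_or_lt with rfl | hlt
      · rw [Uhat_of_le le_rfl, UhatMid_rpow hκ hδ hα.1 hp0 hp2 hq]
      · exact Uhat_of_lt hlt hy
    · rw [← dUhatMid_rpow hκ hδ hα.1 hp0 hq]
      exact hasDerivAt_UhatMid hp0 hp2 hq hb0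
  · refine (hasDerivAt_UhatHigh (by linarith)).congr_of_eventuallyEq ?_
    filter_upwards [Ioi_mem_nhds hlt] with z hz
    exact Uhat_of_le (le_of_lt hz)

lemma hasDerivAt_Uhat_low (hκ : 0 < κ) (hδ : 0 < δ) (hα : α ∈ Ioo (0 : ℝ) 1) (hp0 : 0 < p)
    (hp2 : p < 1) (hq : 0 < p * (1 + κ * δ) - 1) (hy : y ∈ Ioc (0 : ℝ) 1) :
    HasDerivAt (Uhat κ δ p α η) (dUhatLow κ δ p α η y) y := by
  have hb : 1 < α ^ (-p) := one_lt_rpow_of_pos_of_lt_one_of_neg hα.1 hα.2 (by linarith)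
  rcases hy.2.eq_or_lt with rfl | hlt
  · refine hasDerivAt_of_eqOn_Iic_Ici (Iio_mem_nhds hb) (fun y _ hy => Uhat_of_le_one hb hy)
      ?_ (hasDerivAt_UhatLow one_pos) ?_ (f₂ := UhatMid κ δ p α η)
    · intro y hy hyb
      rcases hyb.eq_or_lt with rfl | hlt
      · rw [Uhat_of_le_one hb le_rfl, UhatMid_one hκ hδ hp2 hq]
      · exact Uhat_of_lt hy hlt
    · rw [← dUhatMid_one hκ hδ hq]
      exact hasDerivAt_UhatMid hp0 hp2 hq one_pos
  · refine (hasDerivAt_UhatLow hy.1).congr_of_eventuallyEq ?_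
    filter_upwards [Iio_mem_nhds hlt] with z hz
    exact Uhat_of_le_one hb (le_of_lt hz)

lemma hasDerivAt_Uhat_mid (hκ : 0 < κ) (hδ : 0 < δ) (hα : α ∈ Ioo (0 : ℝ) 1) (hp0 : 0 < p)
    (hp2 : p < 1) (hq : 0 < p * (1 + κ * δ) - 1) (hy : y ∈ Icc 1 (α ^ (-p))) :
    HasDerivAt (Uhat κ δ p α η) (dUhatMid κ δ p α η y) y := by
  rcases hy.1.eq_or_lt with rfl | h1
  · rw [dUhatMid_one hκ hδ hq]
    exact hasDerivAt_Uhat_low hκ hδ hα hp0 hp2 hq ⟨one_pos, le_rfl⟩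
  rcases hy.2.eq_or_lt with rfl | h2
  · rw [dUhatMid_rpow hκ hδ hα.1 hp0 hq]
    exact hasDerivAt_Uhat_high hκ hδ hα hp0 hp2 hq le_rfl
  refine (hasDerivAt_UhatMid hp0 hp2 hq (by linarith)).congr_of_eventuallyEq ?_
  filter_upwards [Ioo_mem_nhds h1 h2] with z hz
  exact Uhat_of_lt hz.2 hz.1

lemma neg_lt_C4 (hκ : 0 < κ) (hδ : 0 < δ) (hq : 0 < p * (1 + κ * δ) - 1)
    (h6 : 0 < C6 κ δ p α η) :
    -(κ / (p * (1 + κ * δ) - 1)) < (1 + κ * δ) * (κ * δ * (1 + κ * δ) * C4 κ δ p α η) := by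
  have hc : 0 < 1 + κ * δ := by positivity
  have hq' := hq.ne'
  rw [C4_eq_C6_sub hκ hδ hq]
  have e : (1 + κ * δ) * (κ * δ * (1 + κ * δ) *
      (C6 κ δ p α η - 1 / (δ * (1 + κ * δ) ^ 2 * (p * (1 + κ * δ) - 1)))) =
      (1 + κ * δ) * (κ * δ * (1 + κ * δ) * C6 κ δ p α η) - κ / (p * (1 + κ * δ) - 1) := by
    generalize p * (1 + κ * δ) - 1 = q at *
    field_simp
  rw [e]
  have : 0 < (1 + κ * δ) * (κ * δ * (1 + κ * δ) * C6 κ δ p α η) := by positivity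
  linarith

/-- A combination with nonpositive first coefficient is positive on `[1, ∞)` if it is at `1`. -/
lemma rpow_combination_pos {K L c r : ℝ} (hK : K ≤ 0) (hKL : 0 < K + L) (hrc : r ≤ c)
    (hy : 1 ≤ y) : 0 < K * y ^ (-c - 1) + L * y ^ (-r - 1) := by
  have h1 : y ^ (-c - 1) ≤ y ^ (-r - 1) := rpow_le_rpow_of_exponent_le hy (by linarith)
  have h2 : 0 < y ^ (-r - 1) := rpow_pos_of_pos (by linarith) _
  nlinarith [mul_pos hKL h2]

lemma strictMonoOn_of_hasDerivAt_pos {s : Set ℝ} {f f' : ℝ → ℝ} (hs : Convex ℝ s)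
    (hf : ∀ x ∈ s, HasDerivAt f (f' x) x) (hpos : ∀ x ∈ s, 0 < f' x) : StrictMonoOn f s := by
  refine strictMonoOn_of_deriv_pos hs (fun x hx => (hf x hx).continuousAt.continuousWithinAt) ?_
  intro x hx
  rw [(hf x (interior_subset hx)).deriv]
  exact hpos x (interior_subset hx)

end Dual

theorem stmt15 (μ σ δ p α κ : ℝ)
    (hμ : 0 < μ) (hσ : 0 < σ) (hδ : 0 < δ) (hκ : κ = 2 * σ ^ 2 / μ ^ 2)
    (hα : α ∈ Set.Ioo (0 : ℝ) 1) (hp1 : 1 / (1 + κ * δ) < p) (hp2 : p < 1) (ystar ηstar y0 : ℝ)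
    (hy : ystar ∈ Set.Ioo (0 : ℝ) 1) (hη : 1 < ηstar)
    (hS : SystemS κ δ p α ystar ηstar) (hy0 : y0 = ηstar * α ^ (-p)) (wstar wα wo : ℝ) (Y : ℝ → ℝ)
    (hwstar : wstar = -deriv (Uhat κ δ p α ηstar) ystar)
    (hwα : wα = -deriv (Uhat κ δ p α ηstar) (α ^ (-p)))
    (hwo : wo = -deriv (Uhat κ δ p α ηstar) 1)
    (hY : ∀ w ∈ Set.Icc (0 : ℝ) wstar,
      Y w ∈ Set.Icc ystar y0 ∧ -deriv (Uhat κ δ p α ηstar) (Y w) = w) :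
    StrictMonoOn (fun w => Y w * deriv (deriv (Uhat κ δ p α ηstar)) (Y w))
        (Set.Ioo 0 wα) ∧
    StrictMonoOn (fun w => Y w * deriv (deriv (Uhat κ δ p α ηstar)) (Y w))
        (Set.Ioo wα wo) ∧
    StrictMonoOn (fun w => Y w * deriv (deriv (Uhat κ δ p α ηstar)) (Y w))
        (Set.Ioo wo wstar) ∧
    ConvexOn ℝ (Set.Ioo 0 wα)
        (fun w => Y w * deriv (deriv (Uhat κ δ p α ηstar)) (Y w)) ∧
    ConvexOn ℝ (Set.Ioo wo wstar)
        (fun w => Y w * deriv (deriv (Uhat κ δ p α ηstar)) (Y w)) ∧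
    ConcaveOn ℝ (Set.Ioo wα wo)
        (fun w => Y w * deriv (deriv (Uhat κ δ p α ηstar)) (Y w)) := by

  have hκ0 : 0 < κ := by rw [hκ]; positivity
  clear hκ
  have hk : 0 < κ * δ := mul_pos hκ0 hδ
  have hc : 0 < 1 + κ * δ := by positivity
  have hp0 : 0 < p := lt_trans (by positivity) hp1
  have hq : 0 < p * (1 + κ * δ) - 1 := by
    rw [div_lt_iff₀ hc] at hp1
    linarith
  have hrc : 1 / p < 1 + κ * δ := by
    rw [div_lt_iff₀ hp0]
    linarith
  have hb : 1 < α ^ (-p) := one_lt_rpow_of_pos_of_lt_one_of_neg hα.1 hα.2 (by linarith)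
  have hby : α ^ (-p) < y0 := by rw [hy0]; nlinarith
  have h2 := C2_pos hκ0 hδ hα hq hy hS
  have h4 := C4_neg hκ0 hδ hq hy hS
  have h6 := C6_pos hκ0 hδ hq hy hS
  have hα0 := hα.1
  have hhigh : ∀ y, α ^ (-p) ≤ y → deriv (Uhat κ δ p α ηstar) y = dUhatHigh κ δ p α ηstar y :=
    fun y hy => (hasDerivAt_Uhat_high hκ0 hδ hα hp0 hp2 hq hy).deriv
  have hmid : ∀ y ∈ Icc 1 (α ^ (-p)), deriv (Uhat κ δ p α ηstar) y = dUhatMid κ δ p α ηstar y :=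
    fun y hy => (hasDerivAt_Uhat_mid hκ0 hδ hα hp0 hp2 hq hy).deriv
  have hlow : ∀ y ∈ Ioc (0 : ℝ) 1, deriv (Uhat κ δ p α ηstar) y = dUhatLow κ δ p α ηstar y :=
    fun y hy => (hasDerivAt_Uhat_low hκ0 hδ hα hp0 hp2 hq hy).deriv
  -- coefficients of `y * Û''(y) = K * y ^ (-c) + L * y ^ (-r)` on the three regions
  set K₁ := κ * δ * (1 + κ * δ) * C2 κ δ p α ηstar with hK₁
  set L₁ := κ * α / (1 + κ * δ) with hL₁
  set K₂ := κ * δ * (1 + κ * δ) * C4 κ δ p α ηstar with hK₂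
  set L₂ := κ * p / (p * (1 + κ * δ) - 1) with hL₂
  set K₃ := κ * δ * (1 + κ * δ) * C6 κ δ p α ηstar with hK₃
  set L₃ := κ / (1 + κ * δ) with hL₃
  have hK₁0 : 0 < K₁ := by positivity
  have hL₁0 : 0 < L₁ := by positivity
  have hK₃0 : 0 < K₃ := by positivity
  have hL₃0 : 0 < L₃ := by positivity
  have hL₂0 : 0 < L₂ := by positivity
  have hK₂0 : K₂ < 0 := mul_neg_of_pos_of_neg (by positivity) h4
  have hcr : 0 < (1 + κ * δ) * K₂ + 1 / p * L₂ := by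
    have e : 1 / p * L₂ = κ / (p * (1 + κ * δ) - 1) := by
      rw [hL₂]
      field_simp
    rw [e]
    linarith [neg_lt_C4 hκ0 hδ hq h6]
  have hKL₂ : 0 < K₂ + L₂ := by nlinarith
  have pos₁ : ∀ y : ℝ, 0 < y → 0 < K₁ * y ^ (-(1 + κ * δ) - 1) + L₁ * y ^ (-(0 : ℝ) - 1) :=
    fun y hy => by positivity
  have pos₃ : ∀ y : ℝ, 0 < y → 0 < K₃ * y ^ (-(1 + κ * δ) - 1) + L₃ * y ^ (-(0 : ℝ) - 1) :=
    fun y hy => by positivity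
  have pos₂ : ∀ y : ℝ, 1 ≤ y → 0 < K₂ * y ^ (-(1 + κ * δ) - 1) + L₂ * y ^ (-(1 / p) - 1) :=
    fun y hy => rpow_combination_pos hK₂0.le hKL₂ hrc.le hy
  have mono₁ : StrictMonoOn (deriv (Uhat κ δ p α ηstar)) (Ici (α ^ (-p))) :=
    (strictMonoOn_of_hasDerivAt_pos (convex_Ici _)
      (fun y hy => hasDerivAt_dUhatHigh (by linarith [mem_Ici.1 hy]))
      (fun y hy => pos₁ y (by linarith [mem_Ici.1 hy]))).congr fun y hy => (hhigh y hy).symm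
  have mono₂ : StrictMonoOn (deriv (Uhat κ δ p α ηstar)) (Icc 1 (α ^ (-p))) :=
    (strictMonoOn_of_hasDerivAt_pos (convex_Icc _ _)
      (fun y hy => hasDerivAt_dUhatMid hp0 (by linarith [hy.1]))
      (fun y hy => pos₂ y hy.1)).congr fun y hy => (hmid y hy).symm
  have mono₃ : StrictMonoOn (deriv (Uhat κ δ p α ηstar)) (Ioc 0 1) :=
    (strictMonoOn_of_hasDerivAt_pos (convex_Ioc _ _)
      (fun y hy => hasDerivAt_dUhatLow hy.1)
      (fun y hy => pos₃ y hy.1)).congr fun y hy => (hlow y hy).symm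
  have mono : StrictMonoOn (deriv (Uhat κ δ p α ηstar)) (Ioi 0) := by
    have h := (mono₃.union mono₂ ⟨⟨one_pos, le_rfl⟩, fun y hy => hy.2⟩
      ⟨⟨le_rfl, hb.le⟩, fun y hy => hy.1⟩).union mono₁ (c := α ^ (-p))
      ⟨Or.inr ⟨hb.le, le_rfl⟩, fun y hy => hy.elim (fun h => h.2.trans hb.le) (fun h => h.2)⟩
      ⟨self_mem_Ici, fun y hy => hy⟩
    rwa [Ioc_union_Icc_eq_Ioc one_pos hb.le, Ioc_union_Ici_eq_Ioi (by linarith)] at h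
  have hy00 : (0 : ℝ) < y0 := by linarith
  have hb0 : (0 : ℝ) < α ^ (-p) := by linarith
  have hw0 : deriv (Uhat κ δ p α ηstar) y0 = 0 := by
    rw [hhigh y0 hby.le, hy0]
    exact dUhatHigh_free_boundary hκ0 hδ hα.1 (by linarith) hp2
  have hwα0 : 0 < wα := by
    have := mono (mem_Ioi.2 hb0) (mem_Ioi.2 hy00) hby
    linarith
  have hwαo : wα < wo := by
    have := mono (mem_Ioi.2 one_pos) (mem_Ioi.2 hb0) hb
    linarith
  have hwos : wo < wstar := by
    have := mono (mem_Ioi.2 hy.1) (mem_Ioi.2 one_pos) hy.2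
    linarith
  have locate : ∀ u v : ℝ, 0 < u → 0 < v → ∀ w ∈ Ioo (-deriv (Uhat κ δ p α ηstar) v)
      (-deriv (Uhat κ δ p α ηstar) u), w ∈ Icc 0 wstar → Y w ∈ Ioo u v := by
    intro u v hu hv w hw hw'
    obtain ⟨hYw, hYe⟩ := hY w hw'
    have hYpos : Y w ∈ Ioi (0 : ℝ) := hy.1.trans_le hYw.1
    rw [← hYe] at hw
    exact ⟨(mono.lt_iff_lt hu hYpos).1 (by linarith [hw.2]),
      (mono.lt_iff_lt hYpos hv).1 (by linarith [hw.1])⟩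
  have Y₁ : ∀ w ∈ Ioo 0 wα,
      Y w ∈ Ioo (α ^ (-p)) y0 ∧ -deriv (Uhat κ δ p α ηstar) (Y w) = w := by
    intro w hw
    have hw' : w ∈ Icc 0 wstar := ⟨hw.1.le, by linarith [hw.2]⟩
    exact ⟨locate _ _ hb0 hy00 w (by rwa [hw0, neg_zero, ← hwα]) hw', (hY w hw').2⟩
  have Y₂ : ∀ w ∈ Ioo wα wo,
      Y w ∈ Ioo 1 (α ^ (-p)) ∧ -deriv (Uhat κ δ p α ηstar) (Y w) = w := by
    intro w hw
    have hw' : w ∈ Icc 0 wstar := ⟨by linarith [hw.1], by linarith [hw.2]⟩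
    exact ⟨locate _ _ one_pos hb0 w (by rwa [← hwα, ← hwo]) hw', (hY w hw').2⟩
  have Y₃ : ∀ w ∈ Ioo wo wstar,
      Y w ∈ Ioo ystar 1 ∧ -deriv (Uhat κ δ p α ηstar) (Y w) = w := by
    intro w hw
    have hw' : w ∈ Icc 0 wstar := ⟨by linarith [hw.1], hw.2.le⟩
    exact ⟨locate _ _ hy.1 one_pos w (by rwa [← hwstar, ← hwo]) hw', (hY w hw').2⟩
  have D₁ : ∀ y ∈ Ioo (α ^ (-p)) y0, HasDerivAt (deriv (Uhat κ δ p α ηstar))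
      (K₁ * y ^ (-(1 + κ * δ) - 1) + L₁ * y ^ (-(0 : ℝ) - 1)) y := by
    intro y hy
    refine (hasDerivAt_dUhatHigh (hb0.trans hy.1)).congr_of_eventuallyEq ?_
    filter_upwards [Ioi_mem_nhds hy.1] with z hz
    exact hhigh z (le_of_lt hz)
  have D₂ : ∀ y ∈ Ioo 1 (α ^ (-p)), HasDerivAt (deriv (Uhat κ δ p α ηstar))
      (K₂ * y ^ (-(1 + κ * δ) - 1) + L₂ * y ^ (-(1 / p) - 1)) y := by
    intro y hy
    refine (hasDerivAt_dUhatMid hp0 (one_pos.trans hy.1)).congr_of_eventuallyEq ?_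
    filter_upwards [Ioo_mem_nhds hy.1 hy.2] with z hz
    exact hmid z (Ioo_subset_Icc_self hz)
  have D₃ : ∀ y ∈ Ioo ystar 1, HasDerivAt (deriv (Uhat κ δ p α ηstar))
      (K₃ * y ^ (-(1 + κ * δ) - 1) + L₃ * y ^ (-(0 : ℝ) - 1)) y := by
    intro y hy'
    refine (hasDerivAt_dUhatLow (hy.1.trans hy'.1)).congr_of_eventuallyEq ?_
    filter_upwards [Ioo_mem_nhds hy'.1 hy'.2] with z hz
    exact hlow z ⟨hy.1.trans hz.1, hz.2.le⟩
  have hform : ∀ {K L r lo hi u v : ℝ}, 0 < lo →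
      (∀ y ∈ Ioo lo hi, HasDerivAt (deriv (Uhat κ δ p α ηstar))
        (K * y ^ (-(1 + κ * δ) - 1) + L * y ^ (-r - 1)) y) →
      (∀ w ∈ Ioo u v, Y w ∈ Ioo lo hi ∧ -deriv (Uhat κ δ p α ηstar) (Y w) = w) →
      EqOn (fun w => K * Y w ^ (-(1 + κ * δ)) + L * Y w ^ (-r))
        (fun w => Y w * deriv (deriv (Uhat κ δ p α ηstar)) (Y w)) (Ioo u v) := by
    intro K L r lo hi u v hlo hD hYw w hw
    have hpos := hlo.trans (hYw w hw).1.1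
    simp only [(hD _ (hYw w hw).1).deriv]
    rw [← mul_rpow_sub_one hpos (-(1 + κ * δ)), ← mul_rpow_sub_one hpos (-r)]
    ring
  refine ⟨?_, ?_, ?_, ?_, ?_, ?_⟩
  · refine (strictMonoOn_rpow_comp_rightInverse hb0
      (mono.mono fun y hy => hb0.trans hy.1) (fun y hy => ?_) Y₁).congr (hform hb0 D₁ Y₁)
    have := hb0.trans hy.1
    rw [zero_mul, zero_mul, add_zero]
    positivity
  · refine (strictMonoOn_rpow_comp_rightInverse one_pos
      (mono.mono fun y hy => one_pos.trans hy.1) (fun y hy => ?_) Y₂).congr (hform one_pos D₂ Y₂)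
    exact rpow_combination_pos (mul_nonpos_of_nonneg_of_nonpos hc.le hK₂0.le) hcr hrc.le hy.1.le
  · refine (strictMonoOn_rpow_comp_rightInverse hy.1
      (mono.mono fun z hz => hy.1.trans hz.1) (fun z hz => ?_) Y₃).congr (hform hy.1 D₃ Y₃)
    have := hy.1.trans hz.1
    rw [zero_mul, zero_mul, add_zero]
    positivity
  · exact (convexOn_rpow_comp_rightInverse hb0 hc (by positivity) D₁
      (fun y hy => pos₁ y (hb0.trans hy.1)) Y₁).congr (hform hb0 D₁ Y₁)
  · exact (convexOn_rpow_comp_rightInverse hy.1 hc (by positivity) D₃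
      (fun z hz => pos₃ z (hy.1.trans hz.1)) Y₃).congr (hform hy.1 D₃ Y₃)
  · exact (concaveOn_rpow_comp_rightInverse one_pos hrc
      (mul_nonpos_of_nonpos_of_nonneg hK₂0.le hL₂0.le) D₂
      (fun y hy => pos₂ y hy.1.le) Y₂).congr (hform one_pos D₂ Y₂)

end
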